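/- Let φ ∈ L₂(𝕋¹) have Fourier coefficients φ_n with Σ_{n∈ℤ} |φ_n| = +∞, and let 0 < ρ < 1. Then for every t₀ > 0 there exists t ≥ t₀ such that the series Σ_{n∈ℤ} |φ_n| |n|² |E_{ρ,1}(−n² t^ρ)| diverges; in fact it diverges for every t > 0. -/

import Mathlib

/-- The two-parameter (real) Mittag-Leffler function. -/
noncomputable def mlER (ρ μ x : ℝ) : ℝ := ∑' k : ℕ, x ^ k / Real.Gamma (ρ * k + μ)

open MeasureTheory Set Filter Topology

lemma aux_bern {a x : ℝ} (ha : 0 < a) (hx0 : 0 ≤ x) (hx1 : x ≤ 1) :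
    1 - x ^ a ≤ (a + 1) * (1 - x) := by
  rcases le_total 1 a with h | h
  · have := one_add_mul_self_le_rpow_one_add (s := x - 1) (by linarith) h
    rw [show 1 + (x - 1) = x by ring] at this
    nlinarith
  · have := Real.rpow_le_rpow_of_exponent_ge' hx0 hx1 ha.le h
    rw [Real.rpow_one] at this
    nlinarith

lemma aux_beta {a b : ℝ} (ha : 0 < a) (hb : 0 < b) :
    IntervalIntegrable (fun x : ℝ => x ^ (a - 1) * (1 - x) ^ (b - 1)) volume 0 1 ∧
    ∫ x in (0:ℝ)..1, x ^ (a - 1) * (1 - x) ^ (b - 1) =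
      Real.Gamma a * Real.Gamma b / Real.Gamma (a + b) := by
  have hc := Complex.betaIntegral_convergent (u := a) (v := b) (by simpa) (by simpa)
  have he : ∀ x ∈ Ioc (0:ℝ) 1, ((x : ℂ) ^ ((a:ℂ) - 1) * (1 - (x : ℂ)) ^ ((b:ℂ) - 1)) =
      ((x ^ (a - 1) * (1 - x) ^ (b - 1) : ℝ) : ℂ) := by
    intro x hx
    push_cast
    rw [Complex.ofReal_cpow hx.1.le, Complex.ofReal_cpow (by linarith [hx.2])]
    push_cast
    rfl
  have hi : IntervalIntegrable (fun x : ℝ => ((x ^ (a - 1) * (1 - x) ^ (b - 1) : ℝ) : ℂ))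
      volume 0 1 := by
    refine hc.congr ?_
    rw [uIoc_of_le zero_le_one]
    exact fun x hx => he x hx
  constructor
  · rw [intervalIntegrable_iff_integrableOn_Ioc_of_le zero_le_one] at hi ⊢
    have := hi.re
    simpa [IntegrableOn] using this
  · have h1 := Complex.betaIntegral_eq_Gamma_mul_div (u := a) (v := b) (by simpa) (by simpa)
    have h2 : Complex.betaIntegral a b =
        ((∫ x in (0:ℝ)..1, x ^ (a - 1) * (1 - x) ^ (b - 1) : ℝ) : ℂ) := by
      rw [← intervalIntegral.integral_ofReal, Complex.betaIntegral]
      apply intervalIntegral.integral_congr_ae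
      refine Eventually.of_forall ?_
      rw [uIoc_of_le zero_le_one]
      exact fun x hx => he x hx
    rw [h2] at h1
    rw [← Complex.ofReal_add, Complex.Gamma_ofReal, Complex.Gamma_ofReal,
      Complex.Gamma_ofReal] at h1
    exact_mod_cast h1

lemma aux_int {ρ a : ℝ} (hρ0 : 0 < ρ) (hρ1 : ρ < 1) (ha : 0 < a) :
    IntervalIntegrable (fun x : ℝ => (1 - x ^ a) * (1 - x) ^ (-ρ - 1)) volume 0 1 := by
  have h0 : IntervalIntegrable (fun x : ℝ => x ^ (-ρ)) volume 1 0 :=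
    intervalIntegral.intervalIntegrable_rpow' (by linarith)
  have h1 : IntervalIntegrable (fun x : ℝ => (a + 1) * (1 - x) ^ (-ρ)) volume 0 1 := by
    have := (h0.comp_sub_left 1).const_mul (a + 1)
    simpa using this
  refine h1.mono_fun ?_ ?_
  · exact Measurable.aestronglyMeasurable (by fun_prop)
  · rw [uIoc_of_le zero_le_one]
    refine (ae_restrict_iff' measurableSet_Ioc).2 (Eventually.of_forall fun x hx => ?_)
    have hx0 : 0 ≤ 1 - x := by linarith [hx.2]
    have hxa : x ^ a ≤ 1 := Real.rpow_le_one hx.1.le hx.2 ha.le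
    beta_reduce
    rw [Real.norm_of_nonneg (mul_nonneg (by linarith) (by positivity)),
      Real.norm_of_nonneg (by positivity)]
    rcases hx0.eq_or_lt with h | h
    · have : x = 1 := by linarith
      subst this
      simp only [Real.one_rpow, sub_self, zero_mul]
      positivity
    · calc (1 - x ^ a) * (1 - x) ^ (-ρ - 1) ≤ ((a + 1) * (1 - x)) * (1 - x) ^ (-ρ - 1) := by
            gcongr
            exact aux_bern ha hx.1.le hx.2
        _ = (a + 1) * (1 - x) ^ (-ρ) := by
            rw [Real.rpow_sub_one h.ne']
            field_simp

lemma aux_ibp {ρ a : ℝ} (hρ0 : 0 < ρ) (hρ1 : ρ < 1) (ha : 0 < a) :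
    ρ * ∫ x in (0:ℝ)..1, (1 - x ^ a) * (1 - x) ^ (-ρ - 1) =
      Real.Gamma (1 - ρ) * Real.Gamma (a + 1) / Real.Gamma (a - ρ + 1) - 1 := by
  obtain ⟨hb, hbe⟩ := aux_beta (b := 1 - ρ) ha (by linarith)
  have hI := aux_int hρ0 hρ1 ha
  have key := intervalIntegral.integral_eq_sub_of_hasDerivAt_of_le (a := 0) (b := 1)
    (f := fun x : ℝ => (1 - x ^ a) * (1 - x) ^ (-ρ))
    (f' := fun x : ℝ => ρ * ((1 - x ^ a) * (1 - x) ^ (-ρ - 1)) -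
      a * (x ^ (a - 1) * (1 - x) ^ (1 - ρ - 1))) zero_le_one ?_ ?_ ?_
  · rw [intervalIntegral.integral_sub (hI.const_mul _) (hb.const_mul _),
      intervalIntegral.integral_const_mul, intervalIntegral.integral_const_mul, hbe] at key
    simp only [Real.one_rpow, sub_self, zero_mul, Real.zero_rpow ha.ne', sub_zero,
      zero_sub, mul_one] at key
    rw [Real.Gamma_add_one ha.ne', show a - ρ + 1 = a + (1 - ρ) by ring]
    linear_combination key
  · intro x hx
    rcases hx.2.eq_or_lt with h | h
    · subst h
      have hlim : Tendsto (fun x : ℝ => (a + 1) * (1 - x) ^ (1 - ρ)) (𝓝[Icc 0 1] 1) (𝓝 0) := by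
        have : ContinuousAt (fun x : ℝ => (a + 1) * (1 - x) ^ (1 - ρ)) 1 := by
          apply ContinuousAt.mul continuousAt_const
          exact ContinuousAt.rpow_const (by fun_prop) (Or.inr (by linarith))
        have h2 := this.tendsto
        simp only [sub_self, Real.zero_rpow (by linarith : 1 - ρ ≠ 0), mul_zero] at h2
        exact h2.mono_left nhdsWithin_le_nhds
      unfold ContinuousWithinAt
      simp only [Real.one_rpow, sub_self, zero_mul]
      refine tendsto_of_tendsto_of_tendsto_of_le_of_le' tendsto_const_nhds hlim ?_ ?_
      · filter_upwards [self_mem_nhdsWithin] with x hx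
        have hxa : x ^ a ≤ 1 := Real.rpow_le_one hx.1 hx.2 ha.le
        exact mul_nonneg (by linarith) (Real.rpow_nonneg (by linarith [hx.2]) _)
      · filter_upwards [self_mem_nhdsWithin] with x hx
        have hx0 : 0 ≤ 1 - x := by linarith [hx.2]
        rcases hx0.eq_or_lt with h | h
        · have : x = 1 := by linarith
          subst this
          simp only [Real.one_rpow, sub_self, zero_mul]
          positivity
        · calc (1 - x ^ a) * (1 - x) ^ (-ρ) ≤ ((a + 1) * (1 - x)) * (1 - x) ^ (-ρ) := by
                gcongr
                exact aux_bern ha hx.1 hx.2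
            _ = (a + 1) * (1 - x) ^ (1 - ρ) := by
                rw [show 1 - ρ = -ρ + 1 by ring, Real.rpow_add_one h.ne']
                ring
    · apply ContinuousAt.continuousWithinAt
      apply ContinuousAt.mul
      · exact continuousAt_const.sub (Real.continuousAt_rpow_const _ _ (Or.inr ha.le))
      · exact ContinuousAt.rpow_const (by fun_prop) (Or.inl (by linarith))
  · intro x hx
    have h1 : HasDerivAt (fun x : ℝ => x ^ a) (a * x ^ (a - 1)) x :=
      Real.hasDerivAt_rpow_const (Or.inl hx.1.ne')
    have h2 : HasDerivAt (fun x : ℝ => (1 - x) ^ (-ρ)) ((-1) * (-ρ) * (1 - x) ^ (-ρ - 1)) x :=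
      ((hasDerivAt_id x).const_sub 1).rpow_const (Or.inl (by simp; linarith [hx.2]))
    refine ((h1.const_sub 1).mul h2).congr_deriv ?_
    rw [show 1 - ρ - 1 = -ρ by ring]
    ring
  · exact (hI.const_mul _).sub (hb.const_mul _)

lemma aux_gamma {ρ x : ℝ} (hρ0 : 0 < ρ) (hx : 0 < x) :
    x ^ ρ * Real.Gamma (x + 1) ≤ Real.Gamma (x + 1 + ρ) := by
  have h := Real.Gamma_mul_add_mul_le_rpow_Gamma_mul_rpow_Gamma (s := x) (t := x + 1 + ρ)
    (a := ρ / (1 + ρ)) (b := 1 / (1 + ρ)) hx (by linarith) (by positivity) (by positivity)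
    (by field_simp; ring)
  rw [show ρ / (1 + ρ) * x + 1 / (1 + ρ) * (x + 1 + ρ) = x + 1 by field_simp; ring] at h
  have g0 := Real.Gamma_pos_of_pos hx
  have g1 := Real.Gamma_pos_of_pos (by linarith : 0 < x + 1)
  have g2 := Real.Gamma_pos_of_pos (by linarith : 0 < x + 1 + ρ)
  have h' := Real.rpow_le_rpow g1.le h (by linarith : 0 ≤ 1 + ρ)
  rw [Real.mul_rpow (by positivity) (by positivity), ← Real.rpow_mul g0.le, ← Real.rpow_mul g2.le,
    div_mul_cancel₀ _ (by linarith), div_mul_cancel₀ _ (by linarith), Real.rpow_one,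
    Real.rpow_add g1, Real.rpow_one] at h'
  have e : Real.Gamma (x + 1) ^ ρ = x ^ ρ * Real.Gamma x ^ ρ := by
    rw [Real.Gamma_add_one hx.ne', Real.mul_rpow hx.le g0.le]
  rw [e] at h'
  have g3 : 0 < Real.Gamma x ^ ρ := by positivity
  refine le_of_mul_le_mul_left ?_ g3
  linarith

lemma aux_gpos {ρ : ℝ} (hρ0 : 0 < ρ) (k : ℕ) : 0 < Real.Gamma (ρ * k + 1) :=
  Real.Gamma_pos_of_pos (by positivity)

lemma aux_summable {ρ : ℝ} (hρ0 : 0 < ρ) (x : ℝ) :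
    Summable (fun k : ℕ => x ^ k / Real.Gamma (ρ * k + 1)) := by
  refine summable_of_ratio_norm_eventually_le (r := 1 / 2) (by norm_num) ?_
  have ht : Tendsto (fun k : ℕ => (ρ * k) ^ ρ) atTop atTop :=
    (tendsto_rpow_atTop hρ0).comp (tendsto_natCast_atTop_atTop.const_mul_atTop hρ0)
  filter_upwards [ht.eventually_ge_atTop (2 * |x|), eventually_gt_atTop 0] with k hk hk0
  have hp : 0 < ρ * k := by positivity
  have hg := aux_gamma hρ0 hp
  have g1 := aux_gpos hρ0 k
  have g2 := aux_gpos hρ0 (k + 1)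
  have e : ρ * k + 1 + ρ = ρ * ((k + 1 : ℕ) : ℝ) + 1 := by push_cast; ring
  rw [e] at hg
  rw [norm_div, norm_div, norm_pow, norm_pow, Real.norm_of_nonneg g1.le, Real.norm_of_nonneg g2.le,
    Real.norm_eq_abs, div_le_iff₀ g2]
  calc |x| ^ (k + 1) = 1 / 2 * (|x| ^ k / Real.Gamma (ρ * k + 1)) *
        ((2 * |x|) * Real.Gamma (ρ * k + 1)) := by field_simp; ring
    _ ≤ 1 / 2 * (|x| ^ k / Real.Gamma (ρ * k + 1)) * Real.Gamma (ρ * ((k + 1 : ℕ) : ℝ) + 1) := by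
        gcongr
        exact le_trans (by gcongr) hg

lemma aux_cont {ρ : ℝ} (hρ0 : 0 < ρ) (s : ℝ) :
    ContinuousOn (fun x => mlER ρ 1 (-x)) (Icc 0 s) := by
  unfold mlER
  refine continuousOn_tsum (u := fun k : ℕ => s ^ k / Real.Gamma (ρ * k + 1)) ?_
    (aux_summable hρ0 s) ?_
  · intro k
    fun_prop
  · intro k x hx
    have g1 := aux_gpos hρ0 k
    rw [norm_div, norm_pow, norm_neg, Real.norm_of_nonneg g1.le, Real.norm_of_nonneg hx.1]
    have := hx.1
    have := hx.2
    gcongr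

lemma aux_tail {ρ : ℝ} (hρ0 : 0 < ρ) (x : ℝ) :
    HasSum (fun k : ℕ => x ^ (k + 1) / Real.Gamma (ρ * ((k + 1 : ℕ) : ℝ) + 1))
      (mlER ρ 1 x - 1) := by
  have h := (aux_summable hρ0 x).hasSum
  rw [← hasSum_nat_add_iff' 1] at h
  simpa [mlER] using h

/-- Extremum principle. -/
lemma aux_ext {ρ l : ℝ} (hρ0 : 0 < ρ) (hρ1 : ρ < 1) (hl : 0 ≤ l)
    (hmin : ∀ x ∈ Icc 0 l, mlER ρ 1 (-l) ≤ mlER ρ 1 (-x)) :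
    1 ≤ mlER ρ 1 (-l) * (1 + Real.Gamma (1 - ρ) * l) := by
  set G := Real.Gamma (1 - ρ) with hG
  have hGpos : 0 < G := Real.Gamma_pos_of_pos (by linarith)
  have hk : ∀ k : ℕ, 0 < ρ * ((k + 1 : ℕ) : ℝ) := fun k => by positivity
  let J : ℕ → ℝ := fun k => ∫ x in Ioc (0:ℝ) 1,
    (1 - x ^ (ρ * ((k + 1 : ℕ) : ℝ))) * (1 - x) ^ (-ρ - 1)
  have hJ : ∀ k, ρ * J k = G * Real.Gamma (ρ * ((k + 1 : ℕ) : ℝ) + 1) /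
      Real.Gamma (ρ * k + 1) - 1 := by
    intro k
    have := aux_ibp hρ0 hρ1 (hk k)
    rw [intervalIntegral.integral_of_le zero_le_one] at this
    rw [this]
    congr 4
    push_cast; ring
  let F : ℕ → ℝ → ℝ := fun k x => (-l) ^ (k + 1) / Real.Gamma (ρ * ((k + 1 : ℕ) : ℝ) + 1) *
    ((1 - x ^ (ρ * ((k + 1 : ℕ) : ℝ))) * (1 - x) ^ (-ρ - 1))
  have hFi : ∀ k, Integrable (F k) (volume.restrict (Ioc 0 1)) := by
    intro k
    have := aux_int hρ0 hρ1 (hk k)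
    rw [intervalIntegrable_iff_integrableOn_Ioc_of_le zero_le_one] at this
    exact this.const_mul _
  have hFint : ∀ (y : ℝ) k, ρ * (y ^ (k + 1) / Real.Gamma (ρ * ((k + 1 : ℕ) : ℝ) + 1) * J k) =
      G * y * (y ^ k / Real.Gamma (ρ * k + 1)) -
      y ^ (k + 1) / Real.Gamma (ρ * ((k + 1 : ℕ) : ℝ) + 1) := by
    intro y k
    have g1 := (aux_gpos hρ0 k).ne'
    have g2 := (aux_gpos hρ0 (k + 1)).ne'
    have := hJ k
    rw [show ρ * (y ^ (k + 1) / Real.Gamma (ρ * ((k + 1 : ℕ) : ℝ) + 1) * J k) =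
      y ^ (k + 1) / Real.Gamma (ρ * ((k + 1 : ℕ) : ℝ) + 1) * (ρ * J k) by ring, this]
    field_simp
    ring
  have hS : ∀ y : ℝ, HasSum
      (fun k : ℕ => ρ * (y ^ (k + 1) / Real.Gamma (ρ * ((k + 1 : ℕ) : ℝ) + 1) * J k))
      (G * y * mlER ρ 1 y - (mlER ρ 1 y - 1)) := by
    intro y
    simp_rw [hFint]
    exact ((aux_summable hρ0 y).hasSum.mul_left (G * y)).sub (aux_tail hρ0 y)
  have hFsum : Summable fun k => ∫ x in Ioc (0:ℝ) 1, ‖F k x‖ := by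
    have h := (hS l).summable
    rw [summable_mul_left_iff hρ0.ne'] at h
    refine h.congr fun k => ?_
    simp only [J, ← integral_const_mul]
    refine setIntegral_congr_fun measurableSet_Ioc fun x hx => ?_
    have hxa : x ^ (ρ * ((k + 1 : ℕ) : ℝ)) ≤ 1 := Real.rpow_le_one hx.1.le hx.2 (hk k).le
    have h3 : 0 ≤ (1 - x) ^ (-ρ - 1) := Real.rpow_nonneg (by linarith [hx.2]) _
    simp only [F]
    rw [norm_mul, norm_div, norm_pow, norm_neg, Real.norm_of_nonneg hl,
      Real.norm_of_nonneg (aux_gpos hρ0 (k + 1)).le,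
      Real.norm_of_nonneg (mul_nonneg (by linarith) h3)]
  have hmain := (hasSum_integral_of_summable_integral_norm hFi hFsum).mul_left ρ
  have h1 : ρ * ∫ x in Ioc (0:ℝ) 1, ∑' k, F k x =
      G * (-l) * mlER ρ 1 (-l) - (mlER ρ 1 (-l) - 1) := by
    refine hmain.unique ?_
    refine (congrArg (fun f => HasSum f _ _) (funext fun k => ?_)).mpr (hS (-l))
    simp only [J, F, integral_const_mul]
  have h2 : ∫ x in Ioc (0:ℝ) 1, ∑' k, F k x ≤ 0 := by
    refine setIntegral_nonpos measurableSet_Ioc fun x hx => ?_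
    have h3 : 0 ≤ (1 - x) ^ (-ρ - 1) := Real.rpow_nonneg (by linarith [hx.2]) _
    have hxr : x ^ ρ ≤ 1 := Real.rpow_le_one hx.1.le hx.2 hρ0.le
    have hxr0 : 0 ≤ x ^ ρ := Real.rpow_nonneg hx.1.le _
    have hs := ((aux_tail hρ0 (-l)).sub (aux_tail hρ0 (-(l * x ^ ρ)))).mul_right
      ((1 - x) ^ (-ρ - 1))
    have : HasSum (fun k => F k x) ((mlER ρ 1 (-l) - 1 - (mlER ρ 1 (-(l * x ^ ρ)) - 1)) *
        (1 - x) ^ (-ρ - 1)) := by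
      refine (congrArg (fun f => HasSum f _ _) (funext fun k => ?_)).mpr hs
      simp only [F]
      rw [Real.rpow_mul hx.1.le, Real.rpow_natCast, ← neg_mul, mul_pow]
      ring
    rw [this.tsum_eq]
    have := hmin (l * x ^ ρ) ⟨by positivity, by nlinarith⟩
    exact mul_nonpos_of_nonpos_of_nonneg (by linarith) h3
  have h4 := mul_nonpos_of_nonneg_of_nonpos hρ0.le h2
  rw [h1] at h4
  linarith

lemma aux_lower {ρ s : ℝ} (hρ0 : 0 < ρ) (hρ1 : ρ < 1) (hs : 0 ≤ s) :
    1 / (1 + Real.Gamma (1 - ρ) * s) ≤ mlER ρ 1 (-s) := by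
  have hGpos : 0 < Real.Gamma (1 - ρ) := Real.Gamma_pos_of_pos (by linarith)
  obtain ⟨l, hl, hmin⟩ := isCompact_Icc.exists_isMinOn (nonempty_Icc.2 hs) (aux_cont hρ0 s)
  have hmin' : ∀ x ∈ Icc 0 s, mlER ρ 1 (-l) ≤ mlER ρ 1 (-x) := fun x hx => hmin hx
  have h := aux_ext hρ0 hρ1 hl.1 fun x hx => hmin' x ⟨hx.1, hx.2.trans hl.2⟩
  have hl0 := hl.1
  refine le_trans ?_ (hmin' s ⟨hs, le_rfl⟩)
  refine le_trans ?_ ((div_le_iff₀ (by positivity)).2 h)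
  have := hl.2
  gcongr

lemma aux_final (ρ : ℝ) (hρ0 : 0 < ρ) (hρ1 : ρ < 1)
    (φ : ℤ → ℂ) (hφ : ¬ Summable fun n : ℤ => ‖φ n‖) (t : ℝ) (ht : 0 < t) :
    ¬ Summable (fun n : ℤ =>
      ‖φ n‖ * ((n : ℝ)) ^ 2 * |mlER ρ 1 (-((n : ℝ)) ^ 2 * t ^ ρ)|) := by
  intro h
  apply hφ
  have hGpos : 0 < Real.Gamma (1 - ρ) := Real.Gamma_pos_of_pos (by linarith)
  have hT : 0 < t ^ ρ := by positivity
  refine (h.mul_left (1 + Real.Gamma (1 - ρ) * t ^ ρ)).of_norm_bounded_eventually ?_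
  have : ∀ᶠ n : ℤ in cofinite, n ≠ 0 := (finite_singleton (0:ℤ)).compl_mem_cofinite
  filter_upwards [this] with n hn
  have hm : (1:ℝ) ≤ (n:ℝ) ^ 2 := by
    have : (1:ℤ) ≤ n ^ 2 := by have := sq_pos_of_ne_zero hn; omega
    exact_mod_cast this
  have hl := aux_lower (s := (n:ℝ) ^ 2 * t ^ ρ) hρ0 hρ1 (by positivity)
  rw [← neg_mul] at hl
  have hl' := hl.trans (le_abs_self _)
  rw [div_le_iff₀ (by positivity)] at hl'
  rw [norm_norm]
  generalize |mlER ρ 1 (-((n : ℝ)) ^ 2 * t ^ ρ)| = E at *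
  have hE : 0 ≤ E := by
    by_contra hc
    have : 0 < 1 + Real.Gamma (1 - ρ) * ((n:ℝ) ^ 2 * t ^ ρ) := by positivity
    nlinarith
  have : 1 ≤ (1 + Real.Gamma (1 - ρ) * t ^ ρ) * ((n:ℝ) ^ 2 * E) := by nlinarith
  calc ‖φ n‖ = ‖φ n‖ * 1 := by ring
    _ ≤ ‖φ n‖ * ((1 + Real.Gamma (1 - ρ) * t ^ ρ) * ((n:ℝ) ^ 2 * E)) := by gcongr
    _ = _ := by ring

/-- If `Σ |φ_n| = ∞`, then the twice-differentiated solution series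
`Σ |φ_n| n² |E_{ρ,1}(-n² t^ρ)|` diverges for every `t > 0` (in particular
for some `t ≥ t₀`, for every `t₀ > 0`). -/
theorem counterexample_divergence (ρ : ℝ) (hρ0 : 0 < ρ) (hρ1 : ρ < 1)
    (φ : ℤ → ℂ) (hφ : ¬ Summable fun n : ℤ => ‖φ n‖) :
    (∀ t₀ : ℝ, 0 < t₀ → ∃ t ≥ t₀, ¬ Summable (fun n : ℤ =>
      ‖φ n‖ * ((n : ℝ)) ^ 2 * |mlER ρ 1 (-((n : ℝ)) ^ 2 * t ^ ρ)|)) ∧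
    (∀ t : ℝ, 0 < t → ¬ Summable (fun n : ℤ =>
      ‖φ n‖ * ((n : ℝ)) ^ 2 * |mlER ρ 1 (-((n : ℝ)) ^ 2 * t ^ ρ)|)) := by
  exact ⟨fun t₀ h => ⟨t₀, le_rfl, aux_final ρ hρ0 hρ1 φ hφ t₀ h⟩, aux_final ρ hρ0 hρ1 φ hφ⟩
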